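/- Let Ω₀ and Ω₁ be bounded domains in ℂ^n with Ω₀ compactly included in Ω₁. Let φ_j be a sequence of continuous weight functions on Ω₁ such that φ_j = φ on the closure of Ω₀ for all j, and φ_j increases and tends to infinity almost everywhere on Ω₁ \ Ω₀. Assume the space of holomorphic functions in L²(Ω₁, e^{-φ₀}) is dense in the space of holomorphic functions in L²(Ω₀, e^{-φ₀}). Fix z ∈ Ω₀; let K_j be the Bergman kernel of A²(Ω₁, e^{-φ_j}) and K the Bergman kernel of A²(Ω₀, e^{-φ}). Then K_j(z,z) increases to K(z,z). -/

import Mathlib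

open MeasureTheory Filter Set Metric Complex
open scoped ENNReal NNReal Topology

noncomputable section

namespace Berndtsson

instance (n : ℕ) : MeasurableSpace (EuclideanSpace ℂ (Fin n)) := borel _
instance (n : ℕ) : BorelSpace (EuclideanSpace ℂ (Fin n)) := ⟨rfl⟩
instance (n : ℕ) : MeasureSpace (EuclideanSpace ℂ (Fin n)) :=
  ⟨Measure.map (EuclideanSpace.equiv (Fin n) ℂ).symm volume⟩

abbrev Cn (n : ℕ) := EuclideanSpace ℂ (Fin n)

/-- A function `f`, with values in `EReal`, is plurisubharmonic on `s` if it is upper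
semicontinuous on `s` and satisfies the sub-mean value inequality on every complex circle
whose corresponding closed disk is contained in `s` (formulated via continuous majorants,
which for upper semicontinuous integrands is equivalent to the upper-integral form). -/
def PlurisubharmonicOn {E : Type*} [NormedAddCommGroup E] [NormedSpace ℂ E]
    (f : E → EReal) (s : Set E) : Prop :=
  UpperSemicontinuousOn f s ∧
    ∀ z ∈ s, ∀ w : E, ∀ r : ℝ, 0 < r →
      (∀ l : ℂ, ‖l‖ ≤ r → z + l • w ∈ s) →
      ∀ h : ℝ → ℝ, Continuous h →
        (∀ θ : ℝ, f (z + ((r : ℂ) * Complex.exp (θ * Complex.I)) • w) ≤ (h θ : EReal)) →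
        f z ≤ (((2 * Real.pi)⁻¹ * ∫ θ in (0:ℝ)..(2 * Real.pi), h θ : ℝ) : EReal)

/-- Plurisubharmonicity for real-valued functions. -/
def PshOn {E : Type*} [NormedAddCommGroup E] [NormedSpace ℂ E] (f : E → ℝ) (s : Set E) : Prop :=
  PlurisubharmonicOn (fun z => (f z : EReal)) s

/-- A pseudoconvex domain: an open set admitting a plurisubharmonic exhaustion function. -/
def Pseudoconvex {E : Type*} [NormedAddCommGroup E] [NormedSpace ℂ E] (D : Set E) : Prop :=
  IsOpen D ∧ ∃ u : E → ℝ, PshOn u D ∧ ∀ c : ℝ, IsCompact {z ∈ D | u z ≤ c}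

/-- `log` with values in `EReal`, sending nonpositive reals to `⊥`. -/
def elog (x : ℝ) : EReal := if 0 < x then ((Real.log x : ℝ) : EReal) else ⊥

/-- Membership in the weighted Bergman space `A²(Ω, e^{-φ})`. -/
def MemA2 {n : ℕ} (Ω : Set (Cn n)) (φ : Cn n → ℝ) (h : Cn n → ℂ) : Prop :=
  DifferentiableOn ℂ h Ω ∧
    IntegrableOn (fun ζ => ‖h ζ‖ ^ 2 * Real.exp (-φ ζ)) Ω volume

/-- `Kz` is the Bergman kernel of `A²(Ω, e^{-φ})` at the point `z`:
it belongs to the space and reproduces the value at `z` of every member. -/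
def IsBergmanKernelAt {n : ℕ} (Ω : Set (Cn n)) (φ : Cn n → ℝ) (z : Cn n)
    (Kz : Cn n → ℂ) : Prop :=
  MemA2 Ω φ Kz ∧
    ∀ h : Cn n → ℂ, MemA2 Ω φ h →
      ∫ ζ in Ω, h ζ * (starRingEnd ℂ) (Kz ζ) * (Real.exp (-φ ζ) : ℂ) = h z

/-- The Bergman kernel on the diagonal, via its extremal characterization
`K(z,z) = sup {|h(z)|² : h holomorphic on Ω, ∫_Ω |h|² e^{-φ} ≤ 1}`. -/
def bergmanDiag {n : ℕ} (Ω : Set (Cn n)) (φ : Cn n → ℝ) (z : Cn n) : ℝ :=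
  sSup {v : ℝ | ∃ h : Cn n → ℂ, DifferentiableOn ℂ h Ω ∧
    IntegrableOn (fun ζ => ‖h ζ‖ ^ 2 * Real.exp (-φ ζ)) Ω volume ∧
    (∫ ζ in Ω, ‖h ζ‖ ^ 2 * Real.exp (-φ ζ)) ≤ 1 ∧ v = ‖h z‖ ^ 2}

end Berndtsson

namespace Berndtsson

instance volume_isAddHaarMeasure (n : ℕ) : (volume : Measure (Cn n)).IsAddHaarMeasure :=
  (EuclideanSpace.equiv (Fin n) ℂ).symm.toContinuousAddEquiv.isAddHaarMeasure_map volume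

theorem measurePreserving_equiv_symm (n : ℕ) :
    MeasurePreserving (EuclideanSpace.equiv (Fin n) ℂ).symm volume volume :=
  ⟨(EuclideanSpace.equiv (Fin n) ℂ).symm.continuous.measurable, rfl⟩

theorem measurePreserving_circle_smul {n : ℕ} (c : Circle) :
    MeasurePreserving (fun w : Cn n => (c : ℂ) • w) volume volume := by
  have h := volume_preserving_pi (fun _ : Fin n => (rotation c).measurePreserving)
  refine ⟨(continuous_const_smul _).measurable, ?_⟩
  have h1 := ((measurePreserving_equiv_symm n).comp h).map_eq
  have h2 := (measurePreserving_equiv_symm n).map_eq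
  conv_lhs => rw [← h2]
  rw [Measure.map_map (continuous_const_smul _).measurable (measurePreserving_equiv_symm n).measurable]
  exact h1

theorem norm_sq_le_lintegral_circle {n : ℕ} {h : Cn n → ℂ} {z w : Cn n} {r : ℝ}
    (hh : DifferentiableOn ℂ h (ball z r)) (hw : w ∈ ball (0 : Cn n) r) :
    ‖h z‖ₑ ^ 2 ≤ ENNReal.ofReal (2 * Real.pi)⁻¹ *
      ∫⁻ θ in Ioc 0 (2 * Real.pi), ‖h (z + Complex.exp (θ * I) • w)‖ₑ ^ 2 := by
  have hdiff : DifferentiableOn ℂ (fun l : ℂ => h (z + l • w) ^ 2) (closedBall 0 1) := by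
    refine DifferentiableOn.pow (hh.comp (by fun_prop) fun l hl => ?_) 2
    rw [mem_closedBall_zero_iff] at hl
    rw [mem_ball_zero_iff] at hw
    rw [mem_ball_iff_norm, add_sub_cancel_left, norm_smul]
    nlinarith [norm_nonneg w]
  have hmean := (DifferentiableOn.diffContOnCl_ball (c := (0 : ℂ)) (R := |1|)
    (U := closedBall (0 : ℂ) 1) hdiff (by simp)).circleAverage
  rw [Real.circleAverage_def] at hmean
  have hint : ‖∫ θ in (0 : ℝ)..2 * Real.pi, h (z + Complex.exp (θ * I) • w) ^ 2‖ₑ ≤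
      ∫⁻ θ in Ioc 0 (2 * Real.pi), ‖h (z + Complex.exp (θ * I) • w)‖ₑ ^ 2 := by
    rw [intervalIntegral.integral_of_le (by positivity)]
    simp_rw [← enorm_pow]
    exact enorm_integral_le_lintegral_enorm _
  have hz : h z ^ 2 = (2 * Real.pi)⁻¹ •
      ∫ θ in (0 : ℝ)..2 * Real.pi, h (z + Complex.exp (θ * I) • w) ^ 2 := by
    simpa [circleMap] using hmean.symm
  rw [← enorm_pow, hz, enorm_smul, Real.enorm_of_nonneg (by positivity)]
  gcongr

theorem norm_sq_mul_volume_ball_le {n : ℕ} {h : Cn n → ℂ} {z : Cn n} {r : ℝ}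
    (hh : DifferentiableOn ℂ h (ball z r)) :
    ‖h z‖ₑ ^ 2 * volume (ball (0 : Cn n) r) ≤ ∫⁻ ζ in ball z r, ‖h ζ‖ₑ ^ 2 := by
  set H : Cn n → ℝ≥0∞ := (ball z r).indicator fun ζ => ‖h ζ‖ₑ ^ 2 with hH
  have hHm : Measurable H := by
    classical
    rw [hH, ← piecewise_eq_indicator]
    exact (ContinuousOn.measurable_piecewise
      ((ENNReal.continuous_pow 2).comp_continuousOn hh.continuousOn.enorm)
      continuousOn_const measurableSet_ball)
  have hrot (θ : ℝ) : ∫⁻ w, H (z + Complex.exp (θ * I) • w) = ∫⁻ ζ, H ζ := by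
    have h1 := (measurePreserving_circle_smul (n := n) (Circle.exp θ)).lintegral_comp
      (hHm.comp (measurable_const_add z))
    simp only [Circle.coe_exp, Function.comp_def] at h1
    rw [h1, lintegral_add_left_eq_self]
  have hpi : ENNReal.ofReal (2 * Real.pi)⁻¹ * volume (Ioc 0 (2 * Real.pi)) = 1 := by
    rw [Real.volume_Ioc, sub_zero, ← ENNReal.ofReal_mul (by positivity),
      inv_mul_cancel₀ (by positivity), ENNReal.ofReal_one]
  calc ‖h z‖ₑ ^ 2 * volume (ball (0 : Cn n) r)
      = ∫⁻ _ in ball (0 : Cn n) r, ‖h z‖ₑ ^ 2 := by rw [setLIntegral_const]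
    _ ≤ ∫⁻ w in ball (0 : Cn n) r, ENNReal.ofReal (2 * Real.pi)⁻¹ *
          ∫⁻ θ in Ioc 0 (2 * Real.pi), H (z + Complex.exp (θ * I) • w) := by
        refine setLIntegral_mono' measurableSet_ball fun w hw => ?_
        refine (norm_sq_le_lintegral_circle hh hw).trans_eq ?_
        congr 2 with θ
        rw [hH, indicator_of_mem]
        simpa [mem_ball_iff_norm, norm_smul, Complex.norm_exp_ofReal_mul_I] using hw
    _ ≤ ∫⁻ w, ENNReal.ofReal (2 * Real.pi)⁻¹ *
          ∫⁻ θ in Ioc 0 (2 * Real.pi), H (z + Complex.exp (θ * I) • w) :=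
        setLIntegral_le_lintegral _ _
    _ = ∫⁻ ζ, H ζ := by
        rw [lintegral_const_mul' _ _ ENNReal.ofReal_ne_top, lintegral_lintegral_swap]
        · simp_rw [hrot]
          rw [setLIntegral_const, mul_comm (∫⁻ ζ, H ζ), ← mul_assoc, hpi, one_mul]
        · exact (hHm.comp (Continuous.measurable (by fun_prop :
            Continuous fun p : Cn n × ℝ => z + Complex.exp (p.2 * I) • p.1))).aemeasurable
    _ = ∫⁻ ζ in ball z r, ‖h ζ‖ₑ ^ 2 := lintegral_indicator measurableSet_ball _

/-- Point evaluations are bounded on a weighted Bergman space. -/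
theorem exists_norm_sq_le_integral {n : ℕ} {Ω : Set (Cn n)} (hΩ : IsOpen Ω) {φ : Cn n → ℝ}
    (hφ : ContinuousOn φ Ω) {z : Cn n} (hz : z ∈ Ω) :
    ∃ C > 0, ∀ h : Cn n → ℂ, MemA2 Ω φ h →
      ‖h z‖ ^ 2 ≤ C * ∫ ζ in Ω, ‖h ζ‖ ^ 2 * Real.exp (-φ ζ) := by
  obtain ⟨r, hr, hball⟩ := Metric.mem_nhds_iff.1 (inter_mem (hΩ.mem_nhds hz)
    ((hφ.continuousAt (hΩ.mem_nhds hz)).eventually_lt_const (lt_add_one (φ z))))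
  have hvol : 0 < volume.real (ball (0 : Cn n) r) :=
    ENNReal.toReal_pos (measure_ball_pos _ _ hr).ne' measure_ball_lt_top.ne
  refine ⟨(volume.real (ball (0 : Cn n) r))⁻¹ * Real.exp (φ z + 1), by positivity,
    fun h hh => ?_⟩
  have hle : ‖h z‖ₑ ^ 2 * volume (ball (0 : Cn n) r) ≤ ENNReal.ofReal
      (Real.exp (φ z + 1) * ∫ ζ in Ω, ‖h ζ‖ ^ 2 * Real.exp (-φ ζ)) := by
    refine (norm_sq_mul_volume_ball_le (hh.1.mono fun ζ hζ => (hball hζ).1)).trans ?_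
    rw [← integral_const_mul, ofReal_integral_eq_lintegral_ofReal (hh.2.const_mul _)
      (ae_of_all _ fun ζ => by positivity)]
    refine le_trans (setLIntegral_mono' measurableSet_ball fun ζ hζ => ?_)
      (lintegral_mono_set fun ζ hζ => (hball hζ).1)
    rw [← enorm_pow, ← ofReal_norm, norm_pow]
    refine ENNReal.ofReal_le_ofReal ?_
    have hexp : 1 ≤ Real.exp (φ z + 1) * Real.exp (-φ ζ) := by
      rw [← Real.exp_add]
      have : φ ζ < φ z + 1 := (hball hζ).2
      exact Real.one_le_exp (by linarith)
    nlinarith [sq_nonneg ‖h ζ‖]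
  rw [mul_assoc, inv_mul_eq_div, le_div_iff₀ hvol]
  have hreal := ENNReal.toReal_mono ENNReal.ofReal_ne_top hle
  rw [ENNReal.toReal_ofReal (mul_nonneg (Real.exp_pos _).le
    (integral_nonneg fun ζ => by positivity))] at hreal
  simpa [Measure.real] using hreal

theorem continuousOn_norm_sq_mul_exp {n : ℕ} {Ω : Set (Cn n)} {φ : Cn n → ℝ} {h : Cn n → ℂ}
    (hφ : ContinuousOn φ Ω) (hh : DifferentiableOn ℂ h Ω) :
    ContinuousOn (fun ζ => ‖h ζ‖ ^ 2 * Real.exp (-φ ζ)) Ω :=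
  (hh.continuousOn.norm.pow 2).mul hφ.neg.rexp

theorem MemA2.mono_weight {n : ℕ} {Ω : Set (Cn n)} (hΩ : IsOpen Ω) {φ ψ : Cn n → ℝ}
    (hψ : ContinuousOn ψ Ω) (hle : ∀ ζ ∈ Ω, φ ζ ≤ ψ ζ) {h : Cn n → ℂ} (hh : MemA2 Ω φ h) :
    MemA2 Ω ψ h := by
  refine ⟨hh.1, hh.2.mono' ((continuousOn_norm_sq_mul_exp hψ hh.1).aestronglyMeasurable
    hΩ.measurableSet) ?_⟩
  filter_upwards [ae_restrict_mem hΩ.measurableSet] with ζ hζ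
  rw [Real.norm_of_nonneg (by positivity)]
  gcongr
  exact hle ζ hζ

theorem MemA2.sub {n : ℕ} {Ω : Set (Cn n)} (hΩ : IsOpen Ω) {φ : Cn n → ℝ}
    (hφ : ContinuousOn φ Ω) {f g : Cn n → ℂ} (hf : MemA2 Ω φ f) (hg : MemA2 Ω φ g) :
    MemA2 Ω φ (fun ζ => f ζ - g ζ) := by
  have hd : DifferentiableOn ℂ (fun ζ => f ζ - g ζ) Ω := hf.1.sub hg.1
  refine ⟨hd, ((hf.2.const_mul 2).add (hg.2.const_mul 2)).mono'
    ((continuousOn_norm_sq_mul_exp hφ hd).aestronglyMeasurable hΩ.measurableSet)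
    (ae_of_all _ fun ζ => ?_)⟩
  rw [Real.norm_of_nonneg (by positivity)]
  have h1 : ‖f ζ - g ζ‖ ^ 2 ≤ 2 * ‖f ζ‖ ^ 2 + 2 * ‖g ζ‖ ^ 2 := by
    nlinarith [norm_sub_le (f ζ) (g ζ), norm_nonneg (f ζ - g ζ), sq_nonneg (‖f ζ‖ - ‖g ζ‖)]
  calc ‖f ζ - g ζ‖ ^ 2 * Real.exp (-φ ζ)
      ≤ (2 * ‖f ζ‖ ^ 2 + 2 * ‖g ζ‖ ^ 2) * Real.exp (-φ ζ) := by gcongr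
    _ = _ := by simp only [Pi.add_apply]; ring

theorem bddAbove_bergmanDiag {n : ℕ} {Ω : Set (Cn n)} (hΩ : IsOpen Ω) {φ : Cn n → ℝ}
    (hφ : ContinuousOn φ Ω) {z : Cn n} (hz : z ∈ Ω) :
    BddAbove {v : ℝ | ∃ h : Cn n → ℂ, DifferentiableOn ℂ h Ω ∧
      IntegrableOn (fun ζ => ‖h ζ‖ ^ 2 * Real.exp (-φ ζ)) Ω volume ∧
      (∫ ζ in Ω, ‖h ζ‖ ^ 2 * Real.exp (-φ ζ)) ≤ 1 ∧ v = ‖h z‖ ^ 2} := by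
  obtain ⟨C, hC, hbound⟩ := exists_norm_sq_le_integral hΩ hφ hz
  refine ⟨C, ?_⟩
  rintro v ⟨h, hd, hi, h1, rfl⟩
  exact (hbound h ⟨hd, hi⟩).trans (mul_le_of_le_one_right hC.le h1)

/-- A norm-decreasing inclusion of weighted Bergman spaces orders their diagonal kernels. -/
theorem bergmanDiag_mono {n : ℕ} {Ω Ω' : Set (Cn n)} (hΩ : IsOpen Ω)
    {φ ψ : Cn n → ℝ} (hψ : ContinuousOn ψ Ω)
    (hmem : ∀ h, MemA2 Ω' φ h → MemA2 Ω ψ h ∧ ∫ ζ in Ω, ‖h ζ‖ ^ 2 * Real.exp (-ψ ζ) ≤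
      ∫ ζ in Ω', ‖h ζ‖ ^ 2 * Real.exp (-φ ζ)) {z : Cn n} (hz : z ∈ Ω) :
    bergmanDiag Ω' φ z ≤ bergmanDiag Ω ψ z := by
  refine csSup_le_csSup (bddAbove_bergmanDiag hΩ hψ hz) ⟨0, 0, ?_⟩ ?_
  · simp
  · rintro v ⟨h, hd, hi, h1, rfl⟩
    obtain ⟨hm, hle⟩ := hmem h ⟨hd, hi⟩
    exact ⟨h, hm.1, hm.2, hle.trans h1, rfl⟩

theorem norm_sq_le_bergmanDiag_mul {n : ℕ} {Ω : Set (Cn n)} (hΩ : IsOpen Ω) {φ : Cn n → ℝ}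
    (hφ : ContinuousOn φ Ω) {z : Cn n} (hz : z ∈ Ω) {h : Cn n → ℂ} (hh : MemA2 Ω φ h) {t : ℝ}
    (ht : 0 < t) (hle : ∫ ζ in Ω, ‖h ζ‖ ^ 2 * Real.exp (-φ ζ) ≤ t) :
    ‖h z‖ ^ 2 ≤ bergmanDiag Ω φ z * t := by
  have hnorm (ζ : Cn n) : ‖((√t)⁻¹ : ℂ) * h ζ‖ ^ 2 = t⁻¹ * ‖h ζ‖ ^ 2 := by
    rw [norm_mul, mul_pow, norm_inv, Complex.norm_real, inv_pow, Real.norm_eq_abs, sq_abs,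
      Real.sq_sqrt ht.le]
  rw [← div_le_iff₀ ht]
  refine le_csSup (bddAbove_bergmanDiag hΩ hφ hz)
    ⟨fun ζ => ((√t)⁻¹ : ℂ) * h ζ, hh.1.const_mul _, ?_, ?_, ?_⟩
  · simp only [hnorm, mul_assoc]
    exact hh.2.const_mul t⁻¹
  · simp only [hnorm, mul_assoc]
    rw [integral_const_mul, inv_mul_le_iff₀ ht, mul_one]
    exact hle
  · rw [hnorm, div_eq_inv_mul]

/-- If the weights increase to infinity almost everywhere outside `Ω₀` and are constant on `Ω₀`,
the weighted norms over `Ω₁` converge to the weighted norm over `Ω₀`. -/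
theorem tendsto_integral_weights {n : ℕ} {Ω₀ Ω₁ : Set (Cn n)} (hΩ₀ : IsOpen Ω₀) (hΩ₁ : IsOpen Ω₁)
    (hsub : Ω₀ ⊆ Ω₁) {φ : Cn n → ℝ} {φs : ℕ → Cn n → ℝ}
    (hcont : ∀ j, ContinuousOn (φs j) Ω₁) (heq : ∀ j, ∀ ζ ∈ Ω₀, φs j ζ = φ ζ)
    (hmono : ∀ ζ ∈ Ω₁, Monotone fun j => φs j ζ)
    (htends : ∀ᵐ ζ ∂(volume.restrict (Ω₁ \ Ω₀)), Tendsto (fun j => φs j ζ) atTop atTop)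
    {g : Cn n → ℂ} (hg : MemA2 Ω₁ (φs 0) g) :
    Tendsto (fun j => ∫ ζ in Ω₁, ‖g ζ‖ ^ 2 * Real.exp (-φs j ζ)) atTop
      (𝓝 (∫ ζ in Ω₀, ‖g ζ‖ ^ 2 * Real.exp (-φ ζ))) := by
  rw [← inter_eq_right.2 hsub, ← setIntegral_indicator hΩ₀.measurableSet]
  refine tendsto_integral_of_dominated_convergence
    (fun ζ => ‖g ζ‖ ^ 2 * Real.exp (-φs 0 ζ)) (fun j =>
      (continuousOn_norm_sq_mul_exp (hcont j) hg.1).aestronglyMeasurable hΩ₁.measurableSet)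
    hg.2 (fun j => ?_) ?_
  · filter_upwards [ae_restrict_mem hΩ₁.measurableSet] with ζ hζ
    rw [Real.norm_of_nonneg (by positivity)]
    gcongr
    exact hmono ζ hζ j.zero_le
  · rw [ae_restrict_iff' (hΩ₁.measurableSet.diff hΩ₀.measurableSet)] at htends
    filter_upwards [ae_restrict_mem hΩ₁.measurableSet, ae_restrict_of_ae htends] with ζ hζ hlim
    by_cases h0 : ζ ∈ Ω₀
    · simp [h0, heq]
    · rw [indicator_of_notMem h0, ← mul_zero (‖g ζ‖ ^ 2)]
      exact (Real.tendsto_exp_neg_atTop_nhds_zero.comp (hlim ⟨hζ, h0⟩)).const_mul _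

theorem norm_sq_le_of_sub {E : Type*} [SeminormedAddCommGroup E] (u v : E) {δ : ℝ} (hδ : 0 < δ) :
    ‖v‖ ^ 2 ≤ (1 + δ) * ‖u‖ ^ 2 + (1 + δ⁻¹) * ‖u - v‖ ^ 2 := by
  have h1 : ‖v‖ ≤ ‖u‖ + ‖u - v‖ := by
    simpa using norm_sub_le u (u - v)
  have h2 : (1 + δ) * ‖u‖ ^ 2 + (1 + δ⁻¹) * ‖u - v‖ ^ 2 =
      (‖u‖ + ‖u - v‖) ^ 2 + δ * (‖u‖ - δ⁻¹ * ‖u - v‖) ^ 2 := by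
    field_simp
    ring
  rw [h2]
  have h3 : ‖v‖ ^ 2 ≤ (‖u‖ + ‖u - v‖) ^ 2 := by gcongr
  exact h3.trans (le_add_of_nonneg_right (by positivity))

/-- Density in the weighted `L²` norm lets one approximate a competitor for the extremal problem
together with its value at `z`. -/
theorem exists_approx_competitor {n : ℕ} {Ω : Set (Cn n)} (hΩ : IsOpen Ω) {φ : Cn n → ℝ}
    (hφ : ContinuousOn φ Ω) {z : Cn n} (hz : z ∈ Ω) {P : (Cn n → ℂ) → Prop}
    {h : Cn n → ℂ} (hh : MemA2 Ω φ h) (hh1 : ∫ ζ in Ω, ‖h ζ‖ ^ 2 * Real.exp (-φ ζ) ≤ 1)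
    (hdense : ∀ ε > 0, ∃ g, P g ∧ MemA2 Ω φ g ∧
      ∫ ζ in Ω, ‖h ζ - g ζ‖ ^ 2 * Real.exp (-φ ζ) < ε)
    {b t : ℝ} (hb : b < ‖h z‖ ^ 2) (ht : 1 < t) :
    ∃ g, P g ∧ ∫ ζ in Ω, ‖g ζ‖ ^ 2 * Real.exp (-φ ζ) < t ∧ b < ‖g z‖ ^ 2 := by
  obtain ⟨C, hC, hbound⟩ := exists_norm_sq_le_integral hΩ hφ hz
  obtain ⟨δ, hδ, hδt⟩ : ∃ δ : ℝ, 0 < δ ∧ 1 + δ < t := ⟨(t - 1) / 2, by linarith, by linarith⟩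
  obtain ⟨η, hη, hηb⟩ := Metric.mem_nhds_iff.1 ((by fun_prop : ContinuousAt
    (fun w : ℂ => ‖w‖ ^ 2) (h z)).eventually_const_lt hb)
  have hδ' : 0 < 1 + δ⁻¹ := by positivity
  obtain ⟨g, hPg, hg, hgε⟩ := hdense (min (η ^ 2 / C) ((t - (1 + δ)) / (1 + δ⁻¹)))
    (lt_min (by positivity) (div_pos (by linarith) hδ'))
  have hsub := hh.sub hΩ hφ hg
  refine ⟨g, hPg, ?_, hηb ?_⟩
  · have hle : ∫ ζ in Ω, ‖g ζ‖ ^ 2 * Real.exp (-φ ζ) ≤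
        (1 + δ) * (∫ ζ in Ω, ‖h ζ‖ ^ 2 * Real.exp (-φ ζ)) +
        (1 + δ⁻¹) * ∫ ζ in Ω, ‖h ζ - g ζ‖ ^ 2 * Real.exp (-φ ζ) := by
      rw [← integral_const_mul, ← integral_const_mul,
        ← integral_add (hh.2.const_mul _) (hsub.2.const_mul _)]
      refine integral_mono hg.2 ((hh.2.const_mul _).add (hsub.2.const_mul _)) fun ζ => ?_
      simp only [← mul_assoc, ← add_mul]
      gcongr
      exact norm_sq_le_of_sub _ _ hδ
    have h1 := hgε.trans_le (min_le_right _ _)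
    rw [lt_div_iff₀ hδ'] at h1
    nlinarith
  · have h1 := hgε.trans_le (min_le_left _ _)
    rw [lt_div_iff₀ hC] at h1
    rw [mem_ball_iff_norm, norm_sub_rev]
    refine lt_of_pow_lt_pow_left₀ 2 hη.le ((hbound _ hsub).trans_lt ?_)
    rwa [mul_comm]



/-- **Lemma 4.1.**  `Ω₀ ⋐ Ω₁` bounded domains, `φ_j` continuous weights on `Ω₁` with `φ_j = φ`
on `Ω̄₀`, increasing and tending to `∞` a.e. on `Ω₁ \ Ω₀`; if holomorphic functions in
`L²(Ω₁, e^{-φ₀})` are dense in the holomorphic functions in `L²(Ω₀, e^{-φ₀})`, then for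
`z ∈ Ω₀` the Bergman kernels satisfy: `K_j(z,z)` increases to `K(z,z)`. -/
theorem bergman_kernels_increase (n : ℕ) (Ω₀ Ω₁ : Set (Cn n))
    (hΩ₀ : IsOpen Ω₀) (hΩ₀conn : IsConnected Ω₀) (hΩ₀bd : Bornology.IsBounded Ω₀)
    (hΩ₁ : IsOpen Ω₁) (hΩ₁conn : IsConnected Ω₁) (hΩ₁bd : Bornology.IsBounded Ω₁)
    (hcpt : closure Ω₀ ⊆ Ω₁)
    (φ : Cn n → ℝ) (φs : ℕ → Cn n → ℝ)
    (hcont : ∀ j, ContinuousOn (φs j) Ω₁)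
    (heq : ∀ j, ∀ z ∈ closure Ω₀, φs j z = φ z)
    (hmono : ∀ z ∈ Ω₁ \ Ω₀, Monotone fun j => φs j z)
    (htends : ∀ᵐ z ∂(volume.restrict (Ω₁ \ Ω₀)), Tendsto (fun j => φs j z) atTop atTop)
    (hdense : ∀ h : Cn n → ℂ, DifferentiableOn ℂ h Ω₀ →
      IntegrableOn (fun ζ => ‖h ζ‖ ^ 2 * Real.exp (-(φs 0 ζ))) Ω₀ volume →
      ∀ ε : ℝ, 0 < ε → ∃ g : Cn n → ℂ, DifferentiableOn ℂ g Ω₁ ∧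
        IntegrableOn (fun ζ => ‖g ζ‖ ^ 2 * Real.exp (-(φs 0 ζ))) Ω₁ volume ∧
        (∫ ζ in Ω₀, ‖h ζ - g ζ‖ ^ 2 * Real.exp (-(φs 0 ζ))) < ε)
    (z : Cn n) (hz : z ∈ Ω₀) :
    Monotone (fun j => bergmanDiag Ω₁ (φs j) z) ∧
      Tendsto (fun j => bergmanDiag Ω₁ (φs j) z) atTop (nhds (bergmanDiag Ω₀ φ z)) := by
  have hsub : Ω₀ ⊆ Ω₁ := subset_closure.trans hcpt
  have heq' (j : ℕ) : ∀ ζ ∈ Ω₀, φs j ζ = φ ζ := fun ζ hζ => heq j ζ (subset_closure hζ)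
  have hφ : ContinuousOn φ Ω₀ := ((hcont 0).mono hsub).congr fun ζ hζ => (heq' 0 ζ hζ).symm
  have hmono' : ∀ ζ ∈ Ω₁, Monotone fun j => φs j ζ := by
    intro ζ hζ
    by_cases h0 : ζ ∈ Ω₀
    · simp only [heq' _ ζ h0]
      exact monotone_const
    · exact hmono ζ ⟨hζ, h0⟩
  have hrestrict (j : ℕ) (h : Cn n → ℂ) :
      EqOn (fun ζ => ‖h ζ‖ ^ 2 * Real.exp (-φs j ζ)) (fun ζ => ‖h ζ‖ ^ 2 * Real.exp (-φ ζ)) Ω₀ :=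
    fun ζ hζ => by simp only [heq' j ζ hζ]
  have hmem (j : ℕ) (h : Cn n → ℂ) (hh : MemA2 Ω₁ (φs j) h) : MemA2 Ω₀ φ h :=
    ⟨hh.1.mono hsub, (hh.2.mono_set hsub).congr_fun (hrestrict j h) hΩ₀.measurableSet⟩
  have hK : ∀ j, bergmanDiag Ω₁ (φs j) z ≤ bergmanDiag Ω₀ φ z := by
    refine fun j => bergmanDiag_mono hΩ₀ hφ (fun h hh => ⟨hmem j h hh, ?_⟩) hz
    rw [← setIntegral_congr_fun hΩ₀.measurableSet (hrestrict j h)]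
    exact setIntegral_mono_set hh.2 (ae_of_all _ fun ζ => by positivity) hsub.eventuallyLE
  have hKmono : Monotone fun j => bergmanDiag Ω₁ (φs j) z := by
    intro i j hij
    refine bergmanDiag_mono hΩ₁ (hcont j) (fun h hh => ?_) (hsub hz)
    have hm := hh.mono_weight hΩ₁ (hcont j) fun ζ hζ => hmono' ζ hζ hij
    refine ⟨hm, setIntegral_mono_on hm.2 hh.2 hΩ₁.measurableSet fun ζ hζ => ?_⟩
    gcongr
    exact hmono' ζ hζ hij
  refine ⟨hKmono, tendsto_order.2 ⟨fun a ha => ?_, fun a ha =>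
    Eventually.of_forall fun j => (hK j).trans_lt ha⟩⟩
  obtain ⟨_, ⟨h, hd, hi, h1, rfl⟩, hah⟩ :=
    exists_lt_of_lt_csSup (by exact ⟨0, 0, by simp⟩) ha
  obtain ⟨b, hab, hb⟩ := exists_between hah
  obtain ⟨t, hat, ht⟩ : ∃ t : ℝ, a * t < b ∧ 1 < t := by
    have hlim : ∀ᶠ t in 𝓝[>] (1 : ℝ), a * t < b :=
      ((by fun_prop : ContinuousAt (fun t : ℝ => a * t) 1).eventually_lt_const
        (by simpa using hab)).filter_mono nhdsWithin_le_nhds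
    exact (hlim.and self_mem_nhdsWithin).exists
  obtain ⟨g, hg, hgt, hgb⟩ := exists_approx_competitor hΩ₀ hφ hz (P := MemA2 Ω₁ (φs 0))
    ⟨hd, hi⟩ h1 (fun ε hε => by
      obtain ⟨g, hgd, hgi, hgε⟩ := hdense h hd
        (hi.congr_fun (hrestrict 0 h).symm hΩ₀.measurableSet) ε hε
      refine ⟨g, ⟨hgd, hgi⟩, hmem 0 g ⟨hgd, hgi⟩, ?_⟩
      rwa [← setIntegral_congr_fun hΩ₀.measurableSet (hrestrict 0 fun ζ => h ζ - g ζ)]) hb ht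
  filter_upwards [(tendsto_integral_weights hΩ₀ hΩ₁ hsub hcont heq' hmono' htends
    hg).eventually_lt_const hgt] with j hj
  have hgj := hg.mono_weight hΩ₁ (hcont j) fun ζ hζ => hmono' ζ hζ j.zero_le
  have hle := norm_sq_le_bergmanDiag_mul hΩ₁ (hcont j) (hsub hz) hgj (by linarith) hj.le
  nlinarith

end Berndtsson
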